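/- arXiv:1210.0075 — 2 statements merged into one kernel-verified Lean document; each statement's English description precedes it below -/
import Mathlib

section
/- Let C be a covering of a finite set E. There exists a matroid M on E whose closure operator equals SH (i.e. cl_M(X) = SH(X) for all X ⊆ E) if and only if the family {I(x) : x ∈ E} forms a partition of E, i.e. for all x, y ∈ E, either I(x) = I(y) or I(x) ∩ I(y) = ∅. -/
variable {α : Type*}

/-- `C` is a covering of the (finite) universe: a finite family of nonempty
subsets whose union is everything. -/
def IsCovering [Fintype α] (C : Finset (Set α)) : Prop :=
  (∀ K ∈ C, K.Nonempty) ∧ ⋃₀ (C : Set (Set α)) = Set.univ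

/-- The indiscernible neighborhood of `x`: `I(x) = ⋃ {K ∈ C : x ∈ K}`. -/
def indNbhd (C : Finset (Set α)) (x : α) : Set α :=
  ⋃₀ {K | K ∈ C ∧ x ∈ K}

/-- The second covering upper approximation operator:
`SH(X) = ⋃ {K ∈ C : K ∩ X ≠ ∅}`. -/
def SH (C : Finset (Set α)) (X : Set α) : Set α :=
  ⋃₀ {K | K ∈ C ∧ (K ∩ X).Nonempty}

lemma mem_indNbhd_iff {C : Finset (Set α)} {x y : α} :
    y ∈ indNbhd C x ↔ ∃ K ∈ C, x ∈ K ∧ y ∈ K := by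
  simp [indNbhd, and_assoc]

lemma IsCovering.mem_indNbhd_self [Fintype α] {C : Finset (Set α)} (hC : IsCovering C) (x : α) :
    x ∈ indNbhd C x := by
  obtain ⟨K, hK, hx⟩ : x ∈ ⋃₀ (C : Set (Set α)) := hC.2 ▸ Set.mem_univ x
  exact mem_indNbhd_iff.2 ⟨K, hK, hx, hx⟩

lemma SH_eq_biUnion_indNbhd (C : Finset (Set α)) (X : Set α) :
    SH C X = ⋃ x ∈ X, indNbhd C x := by
  ext y
  simp only [SH, Set.mem_sUnion, Set.mem_ofPred_eq, Set.mem_iUnion, mem_indNbhd_iff, Set.Nonempty,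
    Set.mem_inter_iff]
  grind

/-- In the matroid whose independent sets are those on which `f` is injective, the closure of `X`
is the union of the fibres of `f` that meet `X`. -/
lemma closure_comap_freeOn_univ {β : Type*} (f : α → β) (X : Set α) :
    ((Matroid.freeOn Set.univ).comap f).closure X = f ⁻¹' (f '' X) := by
  obtain ⟨I, hI⟩ := ((Matroid.freeOn Set.univ).comap f).exists_isBasis X (by simp)
  obtain ⟨hIX, hinj, -⟩ := Matroid.comap_isBasis_iff.1 hI
  rw [Matroid.freeOn_isBasis_iff] at hIX
  ext x
  rw [← hI.closure_eq_closure, ← hIX.1, Set.mem_preimage]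
  by_cases hx : x ∈ I
  · exact iff_of_true (Matroid.mem_closure_of_mem' _ hx) (Set.mem_image_of_mem f hx)
  · rw [← not_iff_not, hI.indep.notMem_closure_iff_of_notMem hx, Matroid.comap_indep_iff,
      Set.injOn_insert hx]
    simp [hinj]

/-- for a covering `C` of a finite set `E`, there is a matroid
`M` on `E` whose closure operator is `SH` iff the family `{I(x) : x ∈ E}`
forms a partition of `E`. -/
theorem stmt12 [Fintype α] (C : Finset (Set α)) (hC : IsCovering C) :
    (∃ M : Matroid α, M.E = Set.univ ∧ ∀ X : Set α, M.closure X = SH C X) ↔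
      ∀ x y : α, indNbhd C x = indNbhd C y ∨ indNbhd C x ∩ indNbhd C y = ∅ := by
  constructor
  · rintro ⟨M, -, hM⟩ x y
    have hcl : ∀ x, M.closure {x} = indNbhd C x := by simp [hM, SH_eq_biUnion_indNbhd]
    have key : ∀ x z, z ∈ indNbhd C x → indNbhd C z = indNbhd C x := by
      intro x z hz
      have hz' : z ∈ M.closure (insert x ∅) \ M.closure ∅ := by
        simpa [hcl, hM ∅, SH_eq_biUnion_indNbhd] using hz
      simpa [hcl] using Matroid.closure_insert_congr hz'
    refine or_iff_not_imp_right.2 fun h ↦ ?_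
    obtain ⟨z, hzx, hzy⟩ := Set.nonempty_iff_ne_empty.2 h
    rw [← key x z hzx, key y z hzy]
  · intro h
    refine ⟨(Matroid.freeOn Set.univ).comap (indNbhd C), by simp, fun X ↦ ?_⟩
    ext y
    simp only [closure_comap_freeOn_univ, SH_eq_biUnion_indNbhd, Set.mem_preimage, Set.mem_image,
      Set.mem_iUnion, exists_prop]
    refine exists_congr fun x ↦ and_congr_right fun _ ↦ ⟨fun hxy ↦ ?_, fun hy ↦ ?_⟩
    · exact hxy ▸ hC.mem_indNbhd_self y
    · exact (h x y).resolve_right (Set.Nonempty.ne_empty ⟨y, hy, hC.mem_indNbhd_self y⟩)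
end

section
/- Let C be a covering of a finite set E. There exists a matroid M on E whose closure operator equals VH (i.e. cl_M(X) = VH(X) for all X ⊆ E) if and only if the family {VH({x}) : x ∈ E} forms a partition of E, i.e. for all x, y ∈ E, either VH({x}) = VH({y}) or VH({x}) ∩ VH({y}) = ∅. -/
variable {α : Type*}

/-- The neighborhood of `x`: `N(x) = ⋂ {K ∈ C : x ∈ K}`. -/
def nbhd (C : Finset (Set α)) (x : α) : Set α :=
  ⋂₀ {K | K ∈ C ∧ x ∈ K}

/-- The seventh covering upper approximation operator:
`VH(X) = ⋃ {N(y) : y ∈ E, N(y) ∩ X ≠ ∅}`. -/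
def VH (C : Finset (Set α)) (X : Set α) : Set α :=
  ⋃₀ {S | ∃ y : α, S = nbhd C y ∧ (nbhd C y ∩ X).Nonempty}

theorem mem_nbhd_self (C : Finset (Set α)) (x : α) : x ∈ nbhd C x :=
  fun _ hK => hK.2

theorem mem_VH_iff {C : Finset (Set α)} {X : Set α} {z : α} :
    z ∈ VH C X ↔ ∃ x ∈ X, z ∈ VH C {x} := by
  constructor
  · rintro ⟨_, ⟨y, rfl, x, hxy, hx⟩, hz⟩
    exact ⟨x, hx, _, ⟨y, rfl, x, hxy, rfl⟩, hz⟩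
  · rintro ⟨x, hx, _, ⟨y, rfl, _, hxy, rfl⟩, hz⟩
    exact ⟨_, ⟨y, rfl, _, hxy, hx⟩, hz⟩

theorem mem_VH_singleton_self (C : Finset (Set α)) (x : α) : x ∈ VH C {x} :=
  ⟨_, ⟨x, rfl, x, mem_nbhd_self C x, rfl⟩, mem_nbhd_self C x⟩

theorem VH_empty (C : Finset (Set α)) : VH C ∅ = ∅ := by
  ext z
  simp [mem_VH_iff (X := ∅)]

/-- for a covering `C` of a finite set `E`, there is a matroid
`M` on `E` whose closure operator is `VH` iff the family `{VH({x}) : x ∈ E}`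
forms a partition of `E`. -/
theorem stmt17 [Fintype α] (C : Finset (Set α)) (hC : IsCovering C) :
    (∃ M : Matroid α, M.E = Set.univ ∧ ∀ X : Set α, M.closure X = VH C X) ↔
      ∀ x y : α, VH C {x} = VH C {y} ∨ VH C {x} ∩ VH C {y} = ∅ := by
  constructor
  · rintro ⟨M, -, hM⟩ x y
    have key : ∀ x z, z ∈ VH C {x} → VH C {z} = VH C {x} := by
      intro x z hz
      have h := M.closure_insert_congr (e := z) (f := x) (X := ∅)
        (by simpa [hM, VH_empty] using hz)
      simpa [hM] using h
    rw [or_iff_not_imp_right, ← ne_eq, ← Set.nonempty_iff_ne_empty]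
    rintro ⟨z, hzx, hzy⟩
    rw [← key x z hzx, key y z hzy]
  · intro h
    have key : ∀ x z, z ∈ VH C {x} ↔ VH C {x} = VH C {z} := by
      intro x z
      refine ⟨fun hz => (h x z).resolve_right ?_, fun hxz => hxz ▸ mem_VH_singleton_self C z⟩
      exact Set.Nonempty.ne_empty ⟨z, hz, mem_VH_singleton_self C z⟩
    refine ⟨(Matroid.freeOn Set.univ).comap fun x => VH C {x}, by simp, fun X => ?_⟩
    ext z
    rw [mem_VH_iff, Matroid.comap_closure_eq, Matroid.freeOn_closure_eq, Set.inter_univ]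
    simp only [key, Set.mem_preimage, Set.mem_image]
end
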